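/- Saint-Venant compatibility: let Ω ⊆ ℝ³ be an open, connected and simply connected set and let ε̂ : Ω → Matrix (Fin 3) (Fin 3) ℝ be a C² matrix field with ε̂(x) symmetric for every x ∈ Ω. Then Curl((Curl ε̂)ᵀ) = 0 on Ω if and only if there exists a map u : Ω → ℝ³ of class C² such that ε̂ = sym(∇u) on Ω. -/

import Mathlib

open Matrix MeasureTheory

noncomputable section

abbrev V3 : Type := Fin 3 → ℝ
abbrev M3 : Type := Matrix (Fin 3) (Fin 3) ℝ

/-- Partial derivative `∂ⱼ f`. -/
def pd (j : Fin 3) (f : V3 → ℝ) (x : V3) : ℝ := fderiv ℝ f x (Pi.single j 1)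

/-- Levi-Civita symbol `ε i j k`. -/
def lc (i j k : Fin 3) : ℝ :=
  ((j.val : ℝ) - i.val) * ((k.val : ℝ) - j.val) * ((k.val : ℝ) - i.val) / 2

/-- Gradient (Jacobian) of a vector field: `(∇u)ᵢⱼ = ∂ⱼ uᵢ`. -/
def grad (u : V3 → V3) (x : V3) : M3 := Matrix.of fun i j => pd j (fun y => u y i) x

/-- curl of a vector field: `(curl u)ᵢ = ε i j k ∂ⱼ uₖ`. -/
def vcurl (u : V3 → V3) (x : V3) : V3 := fun i => ∑ j, ∑ k, lc i j k * pd j (fun y => u y k) x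

/-- divergence of a vector field. -/
def vdiv (u : V3 → V3) (x : V3) : ℝ := ∑ i, pd i (fun y => u y i) x

/-- Row-wise Curl of a matrix field: `(Curl P)ᵢⱼ = ε j k l ∂ₖ P i l`. -/
def mCurl (P : V3 → M3) (x : V3) : M3 :=
  Matrix.of fun i j => ∑ k, ∑ l, lc j k l * pd k (fun y => P y i l) x

/-- Row-wise divergence of a matrix field: `(Div P)ᵢ = ∂ⱼ P i j`. -/
def mDiv (P : V3 → M3) (x : V3) : V3 := fun i => ∑ j, pd j (fun y => P y i j) x

/-- Symmetric part of a matrix. -/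
def symM (X : M3) : M3 := (1/2 : ℝ) • (X + Xᵀ)

/-- Skew-symmetric part of a matrix. -/
def skewM (X : M3) : M3 := (1/2 : ℝ) • (X - Xᵀ)

/-- Deviatoric (trace-free) part of a matrix. -/
def devM (X : M3) : M3 := X - (Matrix.trace X / 3) • (1 : M3)

/-- The axial vector of a (skew-symmetric) matrix: `axl Ā = (Ā₃₂, Ā₁₃, Ā₂₁)`. -/
def axl (X : M3) : V3 := ![X 2 1, X 0 2, X 1 0]

/-- `(anti v)ᵢⱼ = -ε i j k vₖ`. -/
def antiV (v : V3) : M3 := Matrix.of fun i j => -∑ k, lc i j k * v k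

/-- Cross product on `ℝ³`. -/
def cross3 (a b : V3) : V3 := fun i => ∑ j, ∑ k, lc i j k * a j * b k

/-- Euclidean inner product on `ℝ³`. -/
def dot3 (a b : V3) : ℝ := ∑ i, a i * b i

/-- Squared Frobenius norm of a matrix. -/
def frob2 (X : M3) : ℝ := ∑ i, ∑ j, (X i j) ^ 2

section

open Set Filter Topology

theorem pd_congr {Ω : Set V3} (hΩ : IsOpen Ω) {f g : V3 → ℝ} (h : EqOn f g Ω) (j : Fin 3) :
    EqOn (pd j f) (pd j g) Ω := fun x hx => by
  rw [pd, pd, (h.eventuallyEq_of_mem (hΩ.mem_nhds hx)).fderiv_eq]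

theorem contDiffOn_pd {Ω : Set V3} (hΩ : IsOpen Ω) {f : V3 → ℝ} (hf : ContDiffOn ℝ 2 f Ω)
    (j : Fin 3) : ContDiffOn ℝ 1 (pd j f) Ω :=
  (hf.fderiv_of_isOpen hΩ (by norm_num)).clm_apply contDiffOn_const

theorem pd_comm {Ω : Set V3} (hΩ : IsOpen Ω) {f : V3 → ℝ} (hf : ContDiffOn ℝ 2 f Ω) {x : V3}
    (hx : x ∈ Ω) (j k : Fin 3) : pd j (pd k f) x = pd k (pd j f) x := by
  have hd : DifferentiableAt ℝ (fderiv ℝ f) x :=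
    ((hf.fderiv_of_isOpen hΩ (m := 1) (by norm_num)).differentiableOn one_ne_zero).differentiableAt
      (hΩ.mem_nhds hx)
  have hpd : ∀ j k, pd j (pd k f) x = fderiv ℝ (fderiv ℝ f) x (Pi.single j 1) (Pi.single k 1) := by
    intro j k
    have h := hd.hasFDerivAt.clm_apply (hasFDerivAt_const (Pi.single k (1 : ℝ) : V3) x)
    rw [pd, show pd k f = fun y => fderiv ℝ f y (Pi.single k 1) from rfl, h.fderiv]
    simp
  rw [hpd, hpd]
  exact (hf.contDiffAt (hΩ.mem_nhds hx)).isSymmSndFDerivAt (by simp) _ _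

theorem fderiv_eq_sum_pd (f : V3 → ℝ) (x : V3) :
    fderiv ℝ f x = ∑ j, pd j f x • ContinuousLinearMap.proj (R := ℝ) (φ := fun _ => ℝ) j := by
  ext v
  conv_lhs => rw [pi_eq_sum_univ' v]
  simp [pd, mul_comm]

theorem contDiffOn_two_of_pd {Ω : Set V3} (hΩ : IsOpen Ω) {f : V3 → ℝ}
    (hf : DifferentiableOn ℝ f Ω) (hpd : ∀ j, ContDiffOn ℝ 1 (pd j f) Ω) :
    ContDiffOn ℝ 2 f Ω := by
  rw [show (2 : WithTop ℕ∞) = 1 + 1 by norm_num, contDiffOn_succ_iff_fderiv_of_isOpen hΩ]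
  refine ⟨hf, by simp, ?_⟩
  rw [show fderiv ℝ f = _ from funext (fderiv_eq_sum_pd f)]
  exact ContDiffOn.sum fun j _ => (hpd j).smul contDiffOn_const

theorem pd_add {f g : V3 → ℝ} {x : V3} (hf : DifferentiableAt ℝ f x) (hg : DifferentiableAt ℝ g x)
    (j : Fin 3) : pd j (fun y => f y + g y) x = pd j f x + pd j g x := by
  simp [pd, fderiv_fun_add hf hg]

theorem pd_sub {f g : V3 → ℝ} {x : V3} (hf : DifferentiableAt ℝ f x) (hg : DifferentiableAt ℝ g x)
    (j : Fin 3) : pd j (fun y => f y - g y) x = pd j f x - pd j g x := by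
  simp [pd, fderiv_fun_sub hf hg]

theorem pd_const_mul {f : V3 → ℝ} {x : V3} (hf : DifferentiableAt ℝ f x) (c : ℝ)
    (j : Fin 3) : pd j (fun y => c * f y) x = c * pd j f x := by
  simp [pd, fderiv_const_mul hf]

theorem pd_sum {ι : Type*} {s : Finset ι} {f : ι → V3 → ℝ} {x : V3}
    (hf : ∀ i ∈ s, DifferentiableAt ℝ (f i) x) (j : Fin 3) :
    pd j (fun y => ∑ i ∈ s, f i y) x = ∑ i ∈ s, pd j (f i) x := by
  simp [pd, fderiv_fun_sum hf]


/-- On a simply connected, locally path connected space, local functions that differ by locally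
constant functions on overlaps glue, up to locally constant functions, to a global function. The
proof lifts the identity through the covering space that has the local constants as fibres. -/
theorem exists_forall_eventually_sub_eq {X A ι : Type*} [TopologicalSpace X]
    [SimplyConnectedSpace X] [LocallyPathConnectedSpace X] [AddCommGroup A]
    (U : ι → Set X) (hU : ∀ i, IsOpen (U i)) (hcover : ∀ x, ∃ i, x ∈ U i) (f : ι → X → A)
    (hf : ∀ i j, ∀ x ∈ U i ∩ U j, ∀ᶠ y in 𝓝 x, f i y - f j y = f i x - f j x) :
    ∃ g : X → A, ∀ i, ∀ x ∈ U i, ∀ᶠ y in 𝓝 x, g y - f i y = g x - f i x := by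
  let _ : TopologicalSpace A := ⊥
  have : DiscreteTopology A := ⟨rfl⟩
  choose at' hat' using hcover
  let Z : FiberBundleCore ι X A :=
    { baseSet := U
      isOpen_baseSet := hU
      indexAt := at'
      mem_baseSet_at := hat'
      coordChange := fun i j x v => v + (f i x - f j x)
      coordChange_self := by simp
      continuousOn_coordChange := by
        rintro i j ⟨x, v⟩ ⟨hx, -⟩
        refine ContinuousAt.continuousWithinAt (continuousAt_snd.add ?_)
        have : ContinuousAt (fun y => f i y - f j y) x := by
          rw [ContinuousAt, nhds_discrete A, tendsto_pure]
          exact hf i j x hx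
        exact ContinuousAt.comp (x := (x, v)) (f := Prod.fst) this continuousAt_fst
      coordChange_comp := by intros; abel }
  obtain ⟨x₀⟩ : Nonempty X := inferInstance
  have hcov : IsCoveringMap Z.proj := FiberBundle.isCoveringMap (F := A) (E := Z.Fiber)
  obtain ⟨s, ⟨-, hs⟩, -⟩ := hcov.existsUnique_continuousMap_lifts (ContinuousMap.id X) x₀
    (⟨x₀, (0 : A)⟩ : Bundle.TotalSpace A Z.Fiber) rfl
  have hs1 : ∀ x, (s x).1 = x := fun x => congrFun hs x
  let t : X → A := fun x => (s x).2
  have key : ∀ i x, (Z.localTriv i (s x)).2 = t x + (f (at' x) x - f i x) := by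
    intro i x
    rw [Z.localTriv_apply]
    change t x + (f (at' (s x).1) (s x).1 - f i (s x).1) = _
    rw [hs1]
  refine ⟨fun x => t x + f (at' x) x, fun i x hx => ?_⟩
  have hc : ContinuousAt (fun y => (Z.localTriv i (s y)).2) x := by
    refine continuousAt_snd.comp (ContinuousAt.comp (f := s) ?_ s.continuous.continuousAt)
    refine (Z.localTriv i).continuousAt ?_
    rw [(Z.localTriv i).mem_source]
    change (s x).1 ∈ U i
    rwa [hs1]
  rw [ContinuousAt, nhds_discrete A, tendsto_pure] at hc
  filter_upwards [hc] with y hy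
  rw [key, key] at hy
  simpa [add_sub_assoc] using hy

/-- Poincaré lemma: a closed `1`-form on a simply connected open set has a primitive. -/
theorem exists_forall_hasFDerivAt_of_fderiv_symmetric_of_simplyConnected {E F : Type*}
    [NormedAddCommGroup E] [NormedSpace ℝ E] [NormedAddCommGroup F] [NormedSpace ℝ F]
    [CompleteSpace F] {Ω : Set E} (hΩ : IsOpen Ω) [SimplyConnectedSpace Ω] {ω : E → E →L[ℝ] F}
    (hω : DifferentiableOn ℝ ω Ω)
    (hdω : ∀ a ∈ Ω, ∀ x y, fderiv ℝ ω a x y = fderiv ℝ ω a y x) :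
    ∃ f : E → F, ∀ a ∈ Ω, HasFDerivAt f (ω a) a := by
  have : LocallyPathConnectedSpace Ω := hΩ.locallyPathConnectedSpace
  have hball : ∀ a : Ω, ∃ r > 0, Metric.ball (a : E) r ⊆ Ω := fun a =>
    Metric.isOpen_iff.1 hΩ a a.2
  choose r hr hrΩ using hball
  have hprim : ∀ a : Ω, ∃ f : E → F, ∀ b ∈ Metric.ball (a : E) (r a), HasFDerivAt f (ω b) b :=
    fun a => (convex_ball _ _).exists_forall_hasFDerivAt_of_fderiv_symmetric Metric.isOpen_ball
      (hω.mono (hrΩ a)) fun b hb => hdω b (hrΩ a hb)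
  choose f hf using hprim
  obtain ⟨g, hg⟩ := exists_forall_eventually_sub_eq
    (fun a : Ω => Subtype.val ⁻¹' Metric.ball (a : E) (r a))
    (fun a => Metric.isOpen_ball.preimage continuous_subtype_val)
    (fun a => ⟨a, Metric.mem_ball_self (hr a)⟩) (fun a b => f a b) (by
      rintro a b x ⟨hxa, hxb⟩
      have hxs : (x : E) ∈ Metric.ball (a : E) (r a) ∩ Metric.ball (b : E) (r b) := ⟨hxa, hxb⟩
      have hopen : IsOpen (Metric.ball (a : E) (r a) ∩ Metric.ball (b : E) (r b)) :=
        Metric.isOpen_ball.inter Metric.isOpen_ball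
      have hconv : Convex ℝ (Metric.ball (a : E) (r a) ∩ Metric.ball (b : E) (r b)) :=
        (convex_ball _ _).inter (convex_ball _ _)
      filter_upwards [continuous_subtype_val.continuousAt.eventually (hopen.mem_nhds hxs)] with y hy
      have hd : ∀ z ∈ Metric.ball (a : E) (r a) ∩ Metric.ball (b : E) (r b),
          HasFDerivAt (fun z => f a z - f b z) (0 : E →L[ℝ] F) z := fun z hz => by
        simpa using (hf a z hz.1).fun_sub (hf b z hz.2)
      exact hconv.is_const_of_fderivWithin_eq_zero (𝕜 := ℝ)
        (fun z hz => (hd z hz).differentiableAt.differentiableWithinAt)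
        (fun z hz => (hd z hz).hasFDerivWithinAt.fderivWithin (hopen.uniqueDiffWithinAt hz)) hy hxs)
  classical
  refine ⟨fun x => if hx : x ∈ Ω then g ⟨x, hx⟩ else 0, fun a ha => ?_⟩
  have hga := hg ⟨a, ha⟩ ⟨a, ha⟩ (Metric.mem_ball_self (hr _))
  rw [nhds_subtype_eq_comap, eventually_comap] at hga
  refine ((hf ⟨a, ha⟩ a (Metric.mem_ball_self (hr _))).add_const
    (g ⟨a, ha⟩ - f ⟨a, ha⟩ a)).congr_of_eventuallyEq ?_
  filter_upwards [hga, hΩ.mem_nhds ha] with y hy hyΩ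
  rw [dif_pos hyΩ, ← hy ⟨y, hyΩ⟩ rfl]
  abel

/-- Poincaré lemma for `C¹` vector fields with symmetric Jacobian, in terms of partial derivatives. -/
theorem exists_pd_eq {Ω : Set V3} (hΩ : IsOpen Ω) [SimplyConnectedSpace Ω] {w : Fin 3 → V3 → ℝ}
    (hw : ∀ j, ContDiffOn ℝ 1 (w j) Ω)
    (hclosed : ∀ x ∈ Ω, ∀ j k, pd j (w k) x = pd k (w j) x) :
    ∃ f : V3 → ℝ, ContDiffOn ℝ 2 f Ω ∧ ∀ j, EqOn (pd j f) (w j) Ω := by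
  have hd : ∀ x ∈ Ω, ∀ j, DifferentiableAt ℝ (w j) x := fun x hx j =>
    ((hw j).differentiableOn one_ne_zero).differentiableAt (hΩ.mem_nhds hx)
  let ω : V3 → V3 →L[ℝ] ℝ := fun x =>
    ∑ j, w j x • ContinuousLinearMap.proj (R := ℝ) (φ := fun _ => ℝ) j
  have hω : ∀ x ∈ Ω, HasFDerivAt ω (∑ j, (fderiv ℝ (w j) x).smulRight
      (ContinuousLinearMap.proj (R := ℝ) (φ := fun _ => ℝ) j)) x := fun x hx =>
    HasFDerivAt.fun_sum fun j _ => (hd x hx j).hasFDerivAt.smul_const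
      (ContinuousLinearMap.proj (R := ℝ) (φ := fun _ => ℝ) j : V3 →L[ℝ] ℝ)
  obtain ⟨f, hf⟩ := exists_forall_hasFDerivAt_of_fderiv_symmetric_of_simplyConnected hΩ
    (fun x hx => (hω x hx).differentiableAt.differentiableWithinAt) (by
      intro x hx u v
      rw [(hω x hx).fderiv]
      simp only [fderiv_eq_sum_pd (w _) x, Fin.sum_univ_three, hclosed x hx 1 0,
        hclosed x hx 2 0, hclosed x hx 2 1]
      simp
      ring)
  have hpd : ∀ j, EqOn (pd j f) (w j) Ω := by
    intro j x hx
    rw [pd, (hf x hx).fderiv]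
    simp [ω, Pi.single_apply]
  exact ⟨f, contDiffOn_two_of_pd hΩ
    (fun x hx => (hf x hx).differentiableAt.differentiableWithinAt)
    fun j => (hw j).congr (hpd j), hpd⟩

theorem sum_lc_eq_zero_iff {D : Fin 3 → Fin 3 → Fin 3 → Fin 3 → ℝ}
    (hsym : ∀ i j p q, D i j p q = D j i p q) (hcomm : ∀ i j p q, D i j p q = D i j q p) :
    (∀ i j, ∑ k, ∑ l, lc j k l * ∑ m, ∑ n, lc i m n * D l n k m = 0) ↔
      ∀ p q k l, D p k l q - D q k l p = D p l k q - D q l k p := by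
  have s10 := hsym 1 0
  have s20 := hsym 2 0
  have s21 := hsym 2 1
  have c10 := fun i j => hcomm i j 1 0
  have c20 := fun i j => hcomm i j 2 0
  have c21 := fun i j => hcomm i j 2 1
  simp only [Fin.forall_fin_succ, Fin.sum_univ_three, lc]
  norm_num
  simp only [s10, s20, s21, c10, c20, c21]
  constructor
  · rintro ⟨⟨h1, h2, h3⟩, ⟨h4, h5, h6⟩, h7, h8, h9⟩
    clear hsym hcomm s10 s20 s21 c10 c20 c21
    refine ⟨?_, ?_, ?_⟩
    all_goals constructorm* _ ∧ _
    all_goals linarith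
  · intro h
    clear hsym hcomm s10 s20 s21 c10 c20 c21
    casesm* _ ∧ _
    constructorm* _ ∧ _
    all_goals linarith

theorem mCurl_transpose_mCurl_apply {Ω : Set V3} (hΩ : IsOpen Ω) {e : V3 → M3}
    (he : ∀ i j, ContDiffOn ℝ 2 (fun y => e y i j) Ω) {x : V3} (hx : x ∈ Ω) (i j : Fin 3) :
    mCurl (fun y => (mCurl e y)ᵀ) x i j = ∑ k, ∑ l, lc j k l *
      ∑ m, ∑ n, lc i m n * pd k (pd m (fun y => e y l n)) x := by
  have hd : ∀ m l n, DifferentiableAt ℝ (pd m fun y => e y l n) x := fun m l n =>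
    ((contDiffOn_pd hΩ (he l n) m).differentiableOn one_ne_zero).differentiableAt (hΩ.mem_nhds hx)
  simp only [mCurl, Matrix.transpose_apply, Matrix.of_apply]
  refine Finset.sum_congr rfl fun k _ => Finset.sum_congr rfl fun l _ => ?_
  rw [pd_sum fun m _ => DifferentiableAt.fun_sum fun n _ => (hd m l n).const_mul _]
  congr 1
  refine Finset.sum_congr rfl fun m _ => ?_
  rw [pd_sum fun n _ => (hd m l n).const_mul _]
  exact Finset.sum_congr rfl fun n _ => pd_const_mul (hd m l n) _ _

/-- `Curl((Curl e)ᵀ) = 0` says that for all `p`, `q` the vector field `∂_q e_{pk} - ∂_p e_{qk}`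
(index `k`), the gradient of the infinitesimal rotation, is closed. -/
theorem mCurl_transpose_mCurl_eq_zero_iff {Ω : Set V3} (hΩ : IsOpen Ω) {e : V3 → M3}
    (he : ∀ i j, ContDiffOn ℝ 2 (fun y => e y i j) Ω) (hsym : ∀ x ∈ Ω, (e x)ᵀ = e x) {x : V3}
    (hx : x ∈ Ω) :
    mCurl (fun y => (mCurl e y)ᵀ) x = 0 ↔ ∀ p q k l,
      pd k (fun y => pd q (fun z => e z p l) y - pd p (fun z => e z q l) y) x =
        pd l (fun y => pd q (fun z => e z p k) y - pd p (fun z => e z q k) y) x := by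
  have hd : ∀ m l n, DifferentiableAt ℝ (pd m fun y => e y l n) x := fun m l n =>
    ((contDiffOn_pd hΩ (he l n) m).differentiableOn one_ne_zero).differentiableAt (hΩ.mem_nhds hx)
  have hs : ∀ i j p q, pd p (pd q fun y => e y i j) x = pd p (pd q fun y => e y j i) x :=
    fun i j p q => pd_congr hΩ
      (pd_congr hΩ (fun y hy => congrFun (congrFun (hsym y hy) j) i) q) p hx
  simp only [pd_sub (hd _ _ _) (hd _ _ _)]
  rw [← Matrix.ext_iff]
  simp only [mCurl_transpose_mCurl_apply hΩ he hx, Matrix.zero_apply]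
  rw [sum_lc_eq_zero_iff (D := fun i j p q => pd p (pd q fun y => e y i j) x) hs
    fun i j p q => pd_comm hΩ (he i j) hx p q]
  exact forall_congr' fun p => forall_congr' fun q => ⟨fun h k l => h l k, fun h k l => h l k⟩

theorem exists_eq_symM_grad {Ω : Set V3} (hΩ : IsOpen Ω) [SimplyConnectedSpace Ω] {e : V3 → M3}
    (he : ∀ i j, ContDiffOn ℝ 2 (fun y => e y i j) Ω) (hsym : ∀ x ∈ Ω, (e x)ᵀ = e x)
    (h : ∀ x ∈ Ω, mCurl (fun y => (mCurl e y)ᵀ) x = 0) :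
    ∃ u : V3 → V3, ContDiffOn ℝ 2 u Ω ∧ ∀ x ∈ Ω, e x = symM (grad u x) := by
  have hpd := fun m l n => contDiffOn_pd hΩ (he l n) m
  have hs : ∀ i j, EqOn (fun y => e y i j) (fun y => e y j i) Ω :=
    fun i j y hy => congrFun (congrFun (hsym y hy) j) i
  have hω : ∀ p q, ∃ W : V3 → ℝ, ContDiffOn ℝ 2 W Ω ∧ ∀ k, EqOn (pd k W)
      (fun y => pd q (fun z => e z p k) y - pd p (fun z => e z q k) y) Ω := fun p q =>
    exists_pd_eq hΩ (fun k => (hpd q p k).sub (hpd p q k)) fun x hx k l =>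
      (mCurl_transpose_mCurl_eq_zero_iff hΩ he hsym hx).1 (h x hx) p q k l
  choose W hW hWpd using hω
  have hd : ∀ {f : V3 → ℝ}, ContDiffOn ℝ 2 f Ω → ∀ x ∈ Ω, DifferentiableAt ℝ f x :=
    fun hf x hx => (hf.differentiableOn two_ne_zero).differentiableAt (hΩ.mem_nhds hx)
  have hu : ∀ i, ∃ v : V3 → ℝ, ContDiffOn ℝ 2 v Ω ∧ ∀ j, EqOn (pd j v)
      (fun y => e y i j + (1 / 2) * (W i j y - W j i y)) Ω := fun i =>
    exists_pd_eq hΩ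
      (fun j => ((he i j).add (contDiffOn_const.mul ((hW i j).sub (hW j i)))).of_le (by norm_num))
      fun x hx j k => by
        have hsub : ∀ k, DifferentiableAt ℝ (fun y => W i k y - W k i y) x := fun k =>
          (hd (hW i k) x hx).fun_sub (hd (hW k i) x hx)
        have hexp : ∀ j k, pd j (fun y => e y i k + (1 / 2) * (W i k y - W k i y)) x =
            pd j (fun y => e y i k) x +
              (pd k (fun y => e y i j) x - pd i (fun y => e y k j) x) := fun j k => by
          rw [pd_add (hd (he i k) x hx) ((hsub k).const_mul _), pd_const_mul (hsub k),
            pd_sub (hd (hW i k) x hx) (hd (hW k i) x hx), hWpd i k j hx, hWpd k i j hx]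
          ring
        rw [hexp, hexp, pd_congr hΩ (hs k j) i hx]
        ring
  choose u hu hupd using hu
  refine ⟨fun x i => u i x, contDiffOn_pi.2 hu, fun x hx => ?_⟩
  ext i j
  have hij : e x i j = e x j i := hs i j hx
  simp only [symM, grad, Matrix.smul_apply, Matrix.add_apply, Matrix.transpose_apply,
    Matrix.of_apply, smul_eq_mul, hupd i j hx, hupd j i hx, hij]
  ring

theorem mCurl_transpose_mCurl_eq_zero_of_eq_symM_grad {Ω : Set V3} (hΩ : IsOpen Ω) {e : V3 → M3}
    (he : ∀ i j, ContDiffOn ℝ 2 (fun y => e y i j) Ω) (hsym : ∀ x ∈ Ω, (e x)ᵀ = e x)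
    {u : V3 → V3} (hu : ContDiffOn ℝ 2 u Ω) (heu : ∀ x ∈ Ω, e x = symM (grad u x)) :
    ∀ x ∈ Ω, mCurl (fun y => (mCurl e y)ᵀ) x = 0 := by
  intro x hx
  rw [mCurl_transpose_mCurl_eq_zero_iff hΩ he hsym hx]
  intro p q k l
  have hui : ∀ i, ContDiffOn ℝ 2 (fun y => u y i) Ω := contDiffOn_pi.1 hu
  have hpdu := fun j i => contDiffOn_pd hΩ (hui i) j
  have hd : ∀ j i, ∀ y ∈ Ω, DifferentiableAt ℝ (pd j fun z => u z i) y := fun j i y hy =>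
    ((hpdu j i).differentiableOn one_ne_zero).differentiableAt (hΩ.mem_nhds hy)
  have heu' : ∀ i j, EqOn (fun y => e y i j)
      (fun y => (1 / 2) * (pd j (fun z => u z i) y + pd i (fun z => u z j) y)) Ω := by
    intro i j y hy
    simp [heu y hy, symM, grad]
  let W : V3 → ℝ := fun y => (1 / 2) * (pd q (fun z => u z p) y - pd p (fun z => u z q) y)
  have hWpd : ∀ k, EqOn (pd k W)
      (fun y => pd q (fun z => e z p k) y - pd p (fun z => e z q k) y) Ω := by
    intro k y hy
    have hexp : ∀ p q, pd q (fun z => e z p k) y =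
        (1 / 2) * (pd k (pd q fun z => u z p) y + pd q (pd p fun z => u z k) y) := by
      intro p q
      rw [pd_congr hΩ (heu' p k) q hy, pd_const_mul ((hd _ _ y hy).fun_add (hd _ _ y hy)),
        pd_add (hd _ _ y hy) (hd _ _ y hy), pd_comm hΩ (hui p) hy q k]
    simp only [W, hexp]
    rw [pd_const_mul ((hd _ _ y hy).fun_sub (hd _ _ y hy)), pd_sub (hd _ _ y hy) (hd _ _ y hy),
      pd_comm hΩ (hui k) hy q p]
    ring
  have hW : ContDiffOn ℝ 2 W Ω := contDiffOn_two_of_pd hΩ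
    (fun y hy => (((hd _ _ y hy).fun_sub (hd _ _ y hy)).const_mul _).differentiableWithinAt)
    fun k => ((contDiffOn_pd hΩ (he p k) q).sub (contDiffOn_pd hΩ (he q k) p)).congr (hWpd k)
  rw [← pd_congr hΩ (hWpd l) k hx, ← pd_congr hΩ (hWpd k) l hx]
  exact pd_comm hΩ hW hx k l

end

/-- Saint-Venant compatibility condition. -/
theorem saint_venant (Ω : Set V3) (hΩ : IsOpen Ω)
    (hconn : IsConnected Ω) (hsc : SimplyConnectedSpace Ω)
    (e : V3 → M3) (he : ∀ i j, ContDiffOn ℝ 2 (fun y => e y i j) Ω)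
    (hsym : ∀ x ∈ Ω, (e x)ᵀ = e x) :
    (∀ x ∈ Ω, mCurl (fun y => (mCurl e y)ᵀ) x = 0) ↔
      ∃ u : V3 → V3, ContDiffOn ℝ 2 u Ω ∧ ∀ x ∈ Ω, e x = symM (grad u x) := by
  exact ⟨exists_eq_symM_grad hΩ he hsym, fun ⟨_, hu, heu⟩ =>
    mCurl_transpose_mCurl_eq_zero_of_eq_symM_grad hΩ he hsym hu heu⟩
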